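/- There is no 2-body Hamiltonian H : Finset (Fin 3) → ℝ satisfying H(S) ≥ 0 for all states S and {S : H(S) = 0} = {∅, {0,1}, {0,2}, {1,2}}. That is, the ground state set of the parity (XOR) function on two input bits with one output bit cannot be synthesized by any 2-body Hamiltonian on three spins. -/

import Mathlib

/-- No 2-body Hamiltonian on three spins is nonnegative with
ground-state set exactly `{∅, {0,1}, {0,2}, {1,2}}` (the XOR/parity set). -/
theorem no_two_body_xor_on_three_spins :
    ¬ ∃ (H c : Finset (Fin 3) → ℝ),
      (∀ S : Finset (Fin 3), H S = ∑ T ∈ S.powerset, c T) ∧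
      (∀ T : Finset (Fin 3), T.card > 2 → c T = 0) ∧
      (∀ S : Finset (Fin 3), 0 ≤ H S) ∧
      {S : Finset (Fin 3) | H S = 0} =
        {(∅ : Finset (Fin 3)), {0, 1}, {0, 2}, {1, 2}} := by
  rintro ⟨H, c, hH, hc, hpos, hG⟩
  have key : ∀ S : Finset (Fin 3), H S = 0 ↔
      (S = ∅ ∨ S = {0, 1} ∨ S = {0, 2} ∨ S = {1, 2}) := by
    intro S
    have := Set.ext_iff.mp hG S
    simpa using this
  have z0 := (key ∅).2 (by decide)
  have z1 := (key {0, 1}).2 (by decide)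
  have z2 := (key {0, 2}).2 (by decide)
  have z3 := (key {1, 2}).2 (by decide)
  have n0 : H {0} ≠ 0 := fun h => absurd ((key {0}).1 h) (by decide)
  have p0 := hpos {0}
  have p1 := hpos {1}
  have p2 := hpos {2}
  have p3 := hpos {0, 1, 2}
  have c3 := hc {0, 1, 2} (by decide)
  have e (S : Finset (Fin 3)) (P : Finset (Finset (Fin 3))) (h : S.powerset = P) :
      H S = ∑ T ∈ P, c T := by rw [hH, h]
  have h0 := e ∅ {∅} (by decide)
  have h1 := e {0} {∅, {0}} (by decide)
  have h2 := e {1} {∅, {1}} (by decide)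
  have h3 := e {2} {∅, {2}} (by decide)
  have h4 := e {0, 1} {∅, {0}, {1}, {0, 1}} (by decide)
  have h5 := e {0, 2} {∅, {0}, {2}, {0, 2}} (by decide)
  have h6 := e {1, 2} {∅, {1}, {2}, {1, 2}} (by decide)
  have h7 := e {0, 1, 2} {∅, {0}, {1}, {2}, {0, 1}, {0, 2}, {1, 2}, {0, 1, 2}} (by decide)
  rw [Finset.sum_singleton] at h0
  rw [Finset.sum_insert (by decide), Finset.sum_singleton] at h1 h2 h3
  iterate 3 rw [Finset.sum_insert (by decide)] at h4 h5 h6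
  rw [Finset.sum_singleton] at h4 h5 h6
  iterate 7 rw [Finset.sum_insert (by decide)] at h7
  rw [Finset.sum_singleton] at h7
  apply n0
  linarith
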